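/- In M_n(ℂ), the closure ordering on nilpotent conjugation orbits corresponding to partitions of the form 2^k 1^{n-2k} (Jordan type: k blocks of size 2, n−2k blocks of size 1) is linear: the orbit of type 2^j 1^{n-2j} is contained in the closure of the orbit of type 2^k 1^{n-2k} if and only if j ≤ k. Equivalently, for nilpotent matrices A, B with A² = B² = 0, B lies in the closure of the conjugation orbit of A if and only if rank(B) ≤ rank(A). -/

import Mathlib

open Matrix

/-- A square-zero endomorphism of rank `r` admits a linearly independent family of full cardinality
`r + (dim V - 2r) + r` consisting of `r` vectors, some vectors of the kernel, and the images of
the first `r` vectors. -/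
theorem LinearMap.exists_linearIndependent_of_comp_self_eq_zero
    {K V : Type*} [Field K] [AddCommGroup V] [Module K V] [FiniteDimensional K V]
    (f : V →ₗ[K] V) (hf : f ∘ₗ f = 0) (r : ℕ) (hr : Module.finrank K (LinearMap.range f) = r) :
    ∃ (m : ℕ) (u : Fin r → V) (d : Fin m → V), r + (m + r) = Module.finrank K V ∧
      LinearIndependent K (Sum.elim u (Sum.elim d (f ∘ u))) ∧ ∀ i, f (d i) = 0 := by
  have hle : LinearMap.range f ≤ LinearMap.ker f := LinearMap.range_le_ker_iff.2 hf
  obtain ⟨C, hC⟩ := Submodule.exists_isCompl (LinearMap.range f)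
  set D := C ⊓ LinearMap.ker f with hD
  have hsup : LinearMap.range f ⊔ D = LinearMap.ker f := by
    rw [hD, ← sup_inf_assoc_of_le _ hle, hC.sup_eq_top, top_inf_eq]
  have hdisj : Disjoint (LinearMap.range f) D := hC.disjoint.mono_right inf_le_left
  have hdim_ker := Submodule.finrank_sup_add_finrank_inf_eq (LinearMap.range f) D
  rw [hsup, hdisj.eq_bot, finrank_bot] at hdim_ker
  have hrn := LinearMap.finrank_range_add_finrank_ker f
  let w := Module.finBasisOfFinrankEq K (LinearMap.range f) hr
  let d := Module.finBasis K D
  choose u hu using fun i => (w i).2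
  have hfu : f ∘ u = (LinearMap.range f).subtype ∘ w := funext hu
  have hw : LinearIndependent K (f ∘ u) :=
    hfu ▸ w.linearIndependent.map' _ (Submodule.ker_subtype _)
  have hd : LinearIndependent K (D.subtype ∘ d) :=
    d.linearIndependent.map' _ (Submodule.ker_subtype _)
  have hwspan : Submodule.span K (Set.range (f ∘ u)) ≤ LinearMap.range f :=
    Submodule.span_le.2 (by rintro _ ⟨i, rfl⟩; exact ⟨u i, rfl⟩)
  have hdspan : Submodule.span K (Set.range (D.subtype ∘ d)) ≤ D :=
    Submodule.span_le.2 (by rintro _ ⟨i, rfl⟩; exact (d i).2)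
  refine ⟨_, u, D.subtype ∘ d, by omega, ?_, fun i => (d i).2.2⟩
  refine (hw.of_comp f).sum_type
    (hd.sum_type hw (hdisj.symm.mono hdspan hwspan)) ?_
  refine (Submodule.range_ker_disjoint hw).mono_right (Submodule.span_le.2 ?_)
  rintro _ ⟨i | i, rfl⟩
  · exact (d i).2.2
  · exact hle ⟨u i, rfl⟩

namespace Matrix

/-- The matrix with entries `c j` at the positions `(n - 1 - j, j)` and zero elsewhere. -/
def weightedAntidiagonal {R : Type*} [Zero R] {n : ℕ} (c : Fin n → R) : Matrix (Fin n) (Fin n) R :=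
  of fun i j => if i = j.rev then c j else 0

/-- A square-zero matrix of rank `r` is conjugate to the antidiagonal matrix whose first `r` columns
are nonzero with entry `1`. -/
theorem exists_mul_eq_mul_weightedAntidiagonal {K : Type*} [Field K] {n : ℕ}
    (A : Matrix (Fin n) (Fin n) K) (hA : A * A = 0) :
    ∃ P : GL (Fin n) K, A * (P : Matrix (Fin n) (Fin n) K) =
      (P : Matrix (Fin n) (Fin n) K) *
        weightedAntidiagonal fun j : Fin n => if (j : ℕ) < A.rank then 1 else 0 := by
  obtain ⟨m, u, d, hcard, hli, hd⟩ :=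
    LinearMap.exists_linearIndependent_of_comp_self_eq_zero A.mulVecLin
      (by rw [← Matrix.mulVecLin_mul, hA, Matrix.mulVecLin_zero]) A.rank rfl
  generalize A.rank = r at *
  rw [Module.finrank_fin_fun] at hcard
  subst hcard
  let e : Fin r ⊕ (Fin m ⊕ Fin r) ≃ Fin (r + (m + r)) :=
    (Equiv.sumCongr (Equiv.refl _)
      ((Equiv.sumCongr (Equiv.refl _) Fin.revPerm).trans finSumFinEquiv)).trans finSumFinEquiv
  have he₁ (i : Fin r) : (e (.inl i) : ℕ) = i := by simp [e]
  have he₂ (i : Fin m) : (e (.inr (.inl i)) : ℕ) = r + i := by simp [e]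
  have he₃ (i : Fin r) : e (.inr (.inr i)) = (e (.inl i)).rev := by
    ext
    simp [e, Fin.val_rev]
    omega
  set b := Sum.elim u (Sum.elim d (A.mulVecLin ∘ u)) with hb
  have hAb (j : Fin (r + (m + r))) :
      A *ᵥ b (e.symm j) = (if (j : ℕ) < r then (1 : K) else 0) • b (e.symm j.rev) := by
    obtain ⟨x, rfl⟩ := e.surjective j
    rw [e.symm_apply_apply]
    rcases x with i | i | i
    · rw [← he₃, e.symm_apply_apply, he₁, if_pos i.2, one_smul]
      rfl
    · rw [he₂, if_neg (by omega), zero_smul]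
      exact hd i
    · rw [he₃, Fin.val_rev, he₁, if_neg (by omega), zero_smul]
      change A *ᵥ (A *ᵥ u i) = 0
      rw [mulVec_mulVec, hA, zero_mulVec]
  let P : Matrix (Fin (r + (m + r))) (Fin (r + (m + r))) K := of fun i j => b (e.symm j) i
  have hP : IsUnit P :=
    linearIndependent_cols_iff_isUnit.1 (hli.comp _ e.symm.injective)
  refine ⟨hP.unit, ?_⟩
  rw [IsUnit.unit_spec]
  ext i j
  have := congrFun (hAb j) i
  simpa [P, weightedAntidiagonal, mul_apply, mulVec, dotProduct, mul_comm] using this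

/-- Rescaling coordinates deforms the nonzero entries of an antidiagonal matrix. -/
theorem diagonal_mul_weightedAntidiagonal {R : Type*} [CommSemiring R] {n : ℕ}
    (c c' x : Fin n → R) (h : ∀ j, x j.rev * c j = c' j * x j) :
    diagonal x * weightedAntidiagonal c = weightedAntidiagonal c' * diagonal x := by
  ext i j
  rw [diagonal_mul, mul_diagonal]
  by_cases hij : i = j.rev
  · simp [weightedAntidiagonal, hij, h]
  · simp [weightedAntidiagonal, hij]

/-- The set of matrices of rank at most `r` is closed. -/
theorem isClosed_setOf_rank_le {𝕜 : Type*} [NontriviallyNormedField 𝕜] [CompleteSpace 𝕜]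
    {m n : Type*} [Finite m] [Fintype n] (r : ℕ) :
    IsClosed {M : Matrix m n 𝕜 | M.rank ≤ r} := by
  classical
  cases nonempty_fintype m
  have hcont : Continuous fun M : Matrix m n 𝕜 => LinearMap.toContinuousLinearMap M.mulVecLin :=
    LinearMap.continuous_of_finiteDimensional
      ((LinearMap.toContinuousLinearMap (𝕜 := 𝕜) (E := n → 𝕜) (F' := m → 𝕜)).toLinearMap ∘ₗ
        (Matrix.toLin' (R := 𝕜) (m := m) (n := n)).toLinearMap)
  convert ((isOpen_setOfPred_nat_le_rank (r + 1)).preimage hcont).isClosed_compl using 1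
  ext M
  have : (M.mulVecLin.rank : Cardinal) = (M.rank : Cardinal) :=
    (Module.finrank_eq_rank 𝕜 (LinearMap.range M.mulVecLin)).symm
  simp [this]

end Matrix

/-- for nilpotent matrices `A, B ∈ M_n(ℂ)` with `A² = B² = 0`
(Jordan types `2^k 1^{n-2k}`), `B` lies in the closure of the conjugation
orbit of `A` if and only if `rank B ≤ rank A`; i.e. the closure ordering on
such orbits is linear. -/
theorem closure_order_on_square_zero_orbits
    (n : ℕ) (A B : Matrix (Fin n) (Fin n) ℂ) (hA : A * A = 0) (hB : B * B = 0) :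
    B ∈ closure {M : Matrix (Fin n) (Fin n) ℂ |
        ∃ g : GL (Fin n) ℂ, M = (g : Matrix (Fin n) (Fin n) ℂ) * A *
          ((g⁻¹ : GL (Fin n) ℂ) : Matrix (Fin n) (Fin n) ℂ)} ↔
      B.rank ≤ A.rank := by
  constructor
  · refine fun h => closure_minimal ?_ (isClosed_setOf_rank_le A.rank) h
    rintro _ ⟨g, rfl⟩
    exact (rank_mul_le_left _ _).trans (rank_mul_le_right _ _)
  · intro hle
    obtain ⟨P, hP⟩ := exists_mul_eq_mul_weightedAntidiagonal A hA
    obtain ⟨Q, hQ⟩ := exists_mul_eq_mul_weightedAntidiagonal B hB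
    have hdim : A.rank + A.rank ≤ n := by
      simpa using rank_add_rank_le_card_of_mul_eq_zero hA
    let c (t : ℂ) (j : Fin n) : ℂ :=
      if (j : ℕ) < B.rank then 1 else if (j : ℕ) < A.rank then t else 0
    let F (t : ℂ) : Matrix (Fin n) (Fin n) ℂ :=
      Q * weightedAntidiagonal (c t) * ((Q⁻¹ : GL (Fin n) ℂ) : Matrix (Fin n) (Fin n) ℂ)
    have hF0 : F 0 = B := by
      have : c 0 = fun j : Fin n => if (j : ℕ) < B.rank then 1 else 0 := by
        ext j
        simp [c]
      simp only [F, this]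
      rw [← hQ, Units.mul_inv_cancel_right]
    have hcont : Continuous F := by
      have hN : Continuous fun t => weightedAntidiagonal (c t) := continuous_matrix fun i j => ?_
      · exact (continuous_const.matrix_mul hN).matrix_mul continuous_const
      simp only [weightedAntidiagonal, of_apply, c]
      split_ifs <;> fun_prop
    have hlim : Filter.Tendsto F (nhdsWithin 0 {0}ᶜ) (nhds B) :=
      hF0 ▸ hcont.continuousAt.tendsto.mono_left nhdsWithin_le_nhds
    refine mem_closure_of_tendsto hlim ?_
    filter_upwards [self_mem_nhdsWithin] with t ht
    replace ht : t ≠ 0 := ht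
    let x (j : Fin n) : ℂ := if B.rank ≤ (j : ℕ) ∧ (j : ℕ) < A.rank then t⁻¹ else 1
    have hx : IsUnit (diagonal x) := by
      rw [isUnit_diagonal, Pi.isUnit_iff]
      intro j
      simp only [x]
      split_ifs <;> simp [ht]
    have hD := diagonal_mul_weightedAntidiagonal
      (fun j : Fin n => if (j : ℕ) < A.rank then (1 : ℂ) else 0) (c t) x (fun j => by
        have hj := j.2
        by_cases h₁ : (j : ℕ) < A.rank
        · have h₂ : ¬ (n - (j + 1) < A.rank) := by omega
          by_cases h₃ : (j : ℕ) < B.rank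
          · simp [x, c, Fin.val_rev, h₁, h₂, h₃]
          · simp [x, c, Fin.val_rev, h₁, h₂, h₃, not_lt.1 h₃, ht]
        · have h₃ : ¬ (j : ℕ) < B.rank := by omega
          simp [c, h₁, h₃])
    refine ⟨Q * hx.unit * P⁻¹, ?_⟩
    have hPA : ((P⁻¹ : GL (Fin n) ℂ) : Matrix (Fin n) (Fin n) ℂ) * A =
        (weightedAntidiagonal fun j : Fin n => if (j : ℕ) < A.rank then (1 : ℂ) else 0) *
          ((P⁻¹ : GL (Fin n) ℂ) : Matrix (Fin n) (Fin n) ℂ) := by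
      rw [Units.inv_mul_eq_iff_eq_mul, ← mul_assoc, ← hP, Units.mul_inv_cancel_right]
    rw [Units.eq_mul_inv_iff_mul_eq]
    simp only [F, Units.val_mul, IsUnit.unit_spec, mul_assoc, hPA, Units.inv_mul_cancel_left]
    rw [← mul_assoc (diagonal x), hD, mul_assoc]
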